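/- Let M ≥ 1 be an integer and let S_Q ⊆ ℂ be a finite set of nonzero complex numbers with |S_Q| = M that contains two elements of distinct moduli. Let a_i, a_j > 0, θ_i, θ_j ∈ ℝ, and N₀_i, N₀_j > 0. Set A = {a_i·e^{iθ_i}·z : z ∈ S_P^M} and B = {a_j·e^{iθ_j}·w : w ∈ S_Q}. Then klDiv(P_{A,N₀_i}, P_{B,N₀_j}) > 0. (Lemma 1, PSK-versus-QAM case with equal constellation sizes.) -/

import Mathlib

open Real MeasureTheory ProbabilityTheory Filter

/-- The equal-weight homoscedastic complex Gaussian mixture density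
`f_{S,N₀}(r) = (1/|S|) · Σ_{μ ∈ S} (1/(π N₀)) · exp(−|r − μ|²/N₀)`. -/
noncomputable def mixDensity (S : Finset ℂ) (N₀ : ℝ) (r : ℂ) : ℝ :=
  (S.card : ℝ)⁻¹ * ∑ μ ∈ S, (π * N₀)⁻¹ * Real.exp (-(‖r - μ‖) ^ 2 / N₀)

/-- The probability measure `P_{S,N₀}` on `ℂ` with density `f_{S,N₀}` w.r.t. Lebesgue measure. -/
noncomputable def mixMeasure (S : Finset ℂ) (N₀ : ℝ) : Measure ℂ :=
  volume.withDensity fun r => ENNReal.ofReal (mixDensity S N₀ r)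

/-- Kullback–Leibler divergence `∫ log (dP/dQ) dP` of measures (`⊤` if `P` is not absolutely
continuous w.r.t. `Q` or the log-likelihood ratio is not integrable). -/
noncomputable def klDiv {α : Type*} [MeasurableSpace α] (P Q : Measure α) : EReal := by
  classical
  exact if P ≪ Q ∧ Integrable (llr P Q) P then ((∫ x, llr P Q x ∂P : ℝ) : EReal) else ⊤

/-- The `M`-PSK constellation `{exp(2πi·m/M) : m = 0,…,M−1} ⊆ ℂ`. -/
noncomputable def pskConstellation (M : ℕ) : Finset ℂ :=
  (Finset.range M).image fun m : ℕ => Complex.exp (2 * (π : ℂ) * Complex.I * (m : ℂ) / (M : ℂ))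

lemma aux_cont (S : Finset ℂ) (N : ℝ) : Continuous (mixDensity S N) := by
  unfold mixDensity
  fun_prop

lemma aux_nonneg (S : Finset ℂ) (N : ℝ) (hN : 0 < N) (r : ℂ) : 0 ≤ mixDensity S N r := by
  unfold mixDensity
  positivity

lemma aux_int (N : ℝ) (hN : 0 < N) (μ : ℂ) :
    ∫ r : ℂ, Real.exp (-(‖r - μ‖) ^ 2 / N) = π * N := by
  rw [integral_sub_right_eq_self (fun r : ℂ => Real.exp (-(‖r‖) ^ 2 / N)) μ]
  have h := GaussianFourier.integral_rexp_neg_mul_sq_norm (V := ℂ) (b := N⁻¹) (by positivity)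
  rw [Complex.finrank_real_complex] at h
  norm_num at h
  rw [← h]
  congr 1
  ext r
  congr 1
  ring

lemma aux_intble (N : ℝ) (hN : 0 < N) (μ : ℂ) :
    Integrable (fun r : ℂ => Real.exp (-(‖r - μ‖) ^ 2 / N)) := by
  by_contra h
  have h1 := aux_int N hN μ
  rw [integral_undef h] at h1
  have : 0 < π * N := by positivity
  linarith

lemma aux_prob (S : Finset ℂ) (hS : S.Nonempty) (N : ℝ) (hN : 0 < N) :
    IsProbabilityMeasure (mixMeasure S N) := by
  constructor
  unfold mixMeasure
  rw [withDensity_apply _ MeasurableSet.univ, Measure.restrict_univ]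
  have hi : Integrable (mixDensity S N) := by
    unfold mixDensity
    exact (integrable_finsetSum _ fun μ _ => (aux_intble N hN μ).const_mul _).const_mul _
  rw [← ofReal_integral_eq_lintegral_ofReal hi (ae_of_all _ (aux_nonneg S N hN))]
  have : ∫ x, mixDensity S N x = 1 := by
    unfold mixDensity
    rw [integral_const_mul, integral_finsetSum _ fun μ _ => (aux_intble N hN μ).const_mul _]
    simp_rw [integral_const_mul, aux_int N hN]
    have h1 : (S.card : ℝ) ≠ 0 := by exact_mod_cast hS.card_pos.ne'
    have h2 : π * N ≠ 0 := by positivity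
    rw [inv_mul_cancel₀ h2]
    simp [h1]
  rw [this]
  simp

lemma aux_expand (N : ℝ) (r μ : ℂ) :
    Real.exp (-(‖r - μ‖) ^ 2 / N)
      = Real.exp (-‖r‖ ^ 2 / N) * (Real.exp (-‖μ‖ ^ 2 / N) * Real.exp (2 / N * inner ℝ μ r)) := by
  rw [← Real.exp_add, ← Real.exp_add, norm_sub_sq_real, real_inner_comm]
  congr 1
  ring

/-- the character attached to a center -/
noncomputable def auxChar (N : ℝ) (μ : ℂ) : Multiplicative ℂ →* ℝ where
  toFun r := Real.exp (2 / N * inner ℝ μ r.toAdd)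
  map_one' := by simp
  map_mul' x y := by
    rw [← Real.exp_add, toAdd_mul, inner_add_right]
    congr 1
    ring

lemma auxChar_inj (N : ℝ) (hN : 0 < N) : Function.Injective (auxChar N) := by
  intro μ ν h
  have h1 := DFunLike.congr_fun h (Multiplicative.ofAdd (μ - ν))
  have h2 : Real.exp (2 / N * inner ℝ μ (μ - ν)) = Real.exp (2 / N * inner ℝ ν (μ - ν)) := h1
  have h3 := mul_left_cancel₀ (by positivity) (Real.exp_injective h2)
  have h4 : inner ℝ (μ - ν) (μ - ν) = 0 := by rw [inner_sub_left, h3, sub_self]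
  exact sub_eq_zero.1 (inner_self_eq_zero.1 h4)

lemma aux_sub (A B : Finset ℂ) (N : ℝ) (hN : 0 < N)
    (h : ∀ r, mixDensity A N r = mixDensity B N r) : B ⊆ A := by
  classical
  intro ν hν
  by_contra hA
  have hli := (linearIndependent_monoidHom (Multiplicative ℂ) ℝ).comp _ (auxChar_inj N hN)
  rw [linearIndependent_iff'] at hli
  have key := hli (A ∪ B) (fun μ =>
    (if μ ∈ A then (A.card : ℝ)⁻¹ * Real.exp (-‖μ‖ ^ 2 / N) else 0)
    - (if μ ∈ B then (B.card : ℝ)⁻¹ * Real.exp (-‖μ‖ ^ 2 / N) else 0)) ?_ ν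
      (Finset.mem_union_right _ hν)
  · simp only [hA, hν, if_true, if_false, zero_sub, neg_eq_zero] at key
    have : 0 < (B.card : ℝ) := by exact_mod_cast Finset.card_pos.2 ⟨ν, hν⟩
    have : 0 < (B.card : ℝ)⁻¹ * Real.exp (-‖ν‖ ^ 2 / N) := by positivity
    linarith
  · ext r
    have hr := h r.toAdd
    unfold mixDensity at hr
    simp_rw [aux_expand] at hr
    simp only [← Finset.mul_sum] at hr
    have e1 : (π * N)⁻¹ * Real.exp (-‖r.toAdd‖ ^ 2 / N) ≠ 0 := by positivity
    have hr2 : (A.card : ℝ)⁻¹ * ∑ μ ∈ A, Real.exp (-‖μ‖ ^ 2 / N) * auxChar N μ r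
        = (B.card : ℝ)⁻¹ * ∑ μ ∈ B, Real.exp (-‖μ‖ ^ 2 / N) * auxChar N μ r := by
      apply mul_left_cancel₀ e1
      simp only [auxChar, MonoidHom.coe_mk, OneHom.coe_mk]
      linarith
    simp only [Finset.sum_apply, Pi.smul_apply, smul_eq_mul, Function.comp, sub_mul, ite_mul,
      zero_mul, Finset.sum_sub_distrib, Finset.sum_ite_mem, Finset.union_inter_cancel_left,
      Finset.union_inter_cancel_right, Pi.zero_apply]
    simp only [mul_assoc, ← Finset.mul_sum]
    linarith

lemma aux_q (d b c : ℝ) (hd : 0 < d) : Tendsto (fun t : ℝ => d * t ^ 2 + b * t + c) atTop atTop := by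
  have h1 : Tendsto (fun t : ℝ => d * t + b) atTop atTop :=
    tendsto_atTop_add_const_right _ _ (tendsto_id.const_mul_atTop hd)
  have h2 := tendsto_atTop_add_const_right _ c (tendsto_id.atTop_mul_atTop₀ h1)
  refine h2.congr fun t => ?_
  simp only [id]
  ring

lemma aux_term (N s t : ℝ) (μ : ℂ) :
    Real.exp (-(‖(t : ℂ) - μ‖) ^ 2 / N) * Real.exp (s * t ^ 2)
      = Real.exp ((s - N⁻¹) * t ^ 2 + (2 * μ.re / N) * t + (-‖μ‖ ^ 2 / N)) := by
  rw [← Real.exp_add, Complex.sq_norm, Complex.sq_norm, Complex.normSq_apply, Complex.normSq_apply]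
  congr 1
  simp
  ring

lemma aux_zero (S : Finset ℂ) (N s : ℝ) (hs : s < N⁻¹) :
    Tendsto (fun t : ℝ => mixDensity S N t * Real.exp (s * t ^ 2)) atTop (nhds 0) := by
  unfold mixDensity
  simp only [mul_assoc, Finset.sum_mul, aux_term]
  have : ∀ μ ∈ S, Tendsto (fun t : ℝ => (π * N)⁻¹ *
      Real.exp ((s - N⁻¹) * t ^ 2 + (2 * μ.re / N) * t + (-‖μ‖ ^ 2 / N))) atTop (nhds 0) := by
    intro μ _
    rw [← mul_zero (π * N)⁻¹]
    refine Tendsto.const_mul _ (Real.tendsto_exp_atBot.comp ?_)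
    rw [← tendsto_neg_atTop_iff]
    refine (aux_q (N⁻¹ - s) (-(2 * μ.re / N)) (‖μ‖ ^ 2 / N) (by linarith)).congr fun t => ?_
    ring
  have h2 := (tendsto_finsetSum S this).const_mul (S.card : ℝ)⁻¹
  simpa using h2

lemma aux_top (S : Finset ℂ) (hS : S.Nonempty) (N s : ℝ) (hN : 0 < N) (hs : N⁻¹ < s) :
    Tendsto (fun t : ℝ => mixDensity S N t * Real.exp (s * t ^ 2)) atTop atTop := by
  unfold mixDensity
  obtain ⟨μ, hμ⟩ := hS
  have hc : 0 < (S.card : ℝ) := by exact_mod_cast Finset.card_pos.2 ⟨μ, hμ⟩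
  simp only [mul_assoc, Finset.sum_mul, aux_term]
  refine Tendsto.const_mul_atTop (by positivity) ?_
  have h1 : Tendsto (fun t : ℝ => (π * N)⁻¹ *
      Real.exp ((s - N⁻¹) * t ^ 2 + (2 * μ.re / N) * t + (-‖μ‖ ^ 2 / N))) atTop atTop :=
    Tendsto.const_mul_atTop (by positivity)
      (Real.tendsto_exp_atTop.comp (aux_q _ _ _ (by linarith)))
  refine tendsto_atTop_mono (fun t => ?_) h1
  exact Finset.single_le_sum (f := fun μ : ℂ => (π * N)⁻¹ *
      Real.exp ((s - N⁻¹) * t ^ 2 + (2 * μ.re / N) * t + (-‖μ‖ ^ 2 / N)))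
      (fun i _ => by positivity) hμ

lemma aux_le (A B : Finset ℂ) (hB : B.Nonempty) (N N' : ℝ) (hN : 0 < N) (hN' : 0 < N')
    (h : ∀ r, mixDensity A N r = mixDensity B N' r) : N' ≤ N := by
  by_contra! hlt
  obtain ⟨s, h1, h2⟩ := exists_between (inv_strictAnti₀ hN hlt)
  have t1 := aux_zero A N s h2
  have t2 := aux_top B hB N' s hN' h1
  simp only [h] at t1
  exact not_tendsto_nhds_of_tendsto_atTop t2 _ t1

lemma aux_eq_sub (A B : Finset ℂ) (hA : A.Nonempty) (hB : B.Nonempty) (N N' : ℝ)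
    (hN : 0 < N) (hN' : 0 < N') (h : mixMeasure A N = mixMeasure B N') : B ⊆ A := by
  unfold mixMeasure at h
  rw [withDensity_eq_iff_of_sigmaFinite
    (aux_cont A N).measurable.ennreal_ofReal.aemeasurable
    (aux_cont B N').measurable.ennreal_ofReal.aemeasurable] at h
  have h2 : mixDensity A N =ᵐ[volume] mixDensity B N' := by
    filter_upwards [h] with r hr
    exact (ENNReal.ofReal_eq_ofReal_iff (aux_nonneg _ _ hN _) (aux_nonneg _ _ hN' _)).1 hr
  have h3 := congrFun (((aux_cont A N).ae_eq_iff_eq volume (aux_cont B N')).1 h2)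
  have e : N = N' := le_antisymm (aux_le B A hA N' N hN' hN fun r => (h3 r).symm)
    (aux_le A B hB N N' hN hN' h3)
  subst e
  exact aux_sub A B N hN h3

lemma aux_kl {α : Type*} [MeasurableSpace α] (P Q : Measure α) [IsProbabilityMeasure P]
    [IsProbabilityMeasure Q] (h : P ≠ Q) : 0 < klDiv P Q := by
  unfold klDiv
  split_ifs with hc
  · have h1 := InformationTheory.toReal_klDiv_of_measure_eq hc.1 (by simp)
    rw [← h1]
    have h2 := ENNReal.toReal_pos (mt InformationTheory.klDiv_eq_zero_iff.1 h)
      (InformationTheory.klDiv_ne_top hc.1 hc.2)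
    exact_mod_cast h2
  · exact EReal.zero_lt_top

/-- **Lemma 1, PSK-vs-QAM case with equal constellation sizes.** -/
theorem klDiv_psk_qam_pos (M : ℕ) (hM : 1 ≤ M)
    (SQ : Finset ℂ) (hcard : SQ.card = M) (h0 : ∀ w ∈ SQ, w ≠ 0)
    (hmod : ∃ w₁ ∈ SQ, ∃ w₂ ∈ SQ, ‖w₁‖ ≠ ‖w₂‖)
    (ai aj : ℝ) (hai : 0 < ai) (haj : 0 < aj) (θi θj : ℝ)
    (N₀i N₀j : ℝ) (hN₀i : 0 < N₀i) (hN₀j : 0 < N₀j) :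
    0 < klDiv
      (mixMeasure ((pskConstellation M).image
        fun z => (ai : ℂ) * Complex.exp (Complex.I * (θi : ℂ)) * z) N₀i)
      (mixMeasure (SQ.image
        fun w => (aj : ℂ) * Complex.exp (Complex.I * (θj : ℂ)) * w) N₀j) := by
  obtain ⟨w₁, hw₁, w₂, hw₂, hne⟩ := hmod
  have hA : ((pskConstellation M).image
        fun z => (ai : ℂ) * Complex.exp (Complex.I * (θi : ℂ)) * z).Nonempty := by
    apply Finset.Nonempty.image
    apply Finset.Nonempty.image
    exact Finset.nonempty_range_iff.2 (by omega)
  have hB : (SQ.image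
        fun w => (aj : ℂ) * Complex.exp (Complex.I * (θj : ℂ)) * w).Nonempty :=
    Finset.Nonempty.image ⟨w₁, hw₁⟩ _
  have := aux_prob _ hA N₀i hN₀i
  have := aux_prob _ hB N₀j hN₀j
  apply aux_kl
  intro heq
  have hsub := aux_eq_sub _ _ hA hB _ _ hN₀i hN₀j heq
  have key : ∀ w ∈ SQ, aj * ‖w‖ = ai := by
    intro w hw
    have h1 := hsub (Finset.mem_image_of_mem _ hw)
    obtain ⟨z, hz, hzw⟩ := Finset.mem_image.1 h1
    obtain ⟨m, _, rfl⟩ := Finset.mem_image.1 hz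
    have h2 := congrArg norm hzw
    have e : (2 * (π : ℂ) * Complex.I * (m : ℂ) / (M : ℂ))
        = ((2 * π * m / M : ℝ) : ℂ) * Complex.I := by
      push_cast
      ring
    rw [e] at h2
    simp only [norm_mul, mul_comm Complex.I, Complex.norm_exp_ofReal_mul_I, mul_one,
      Complex.norm_real, Real.norm_eq_abs, abs_of_pos hai, abs_of_pos haj] at h2
    exact h2.symm
  exact hne (mul_left_cancel₀ haj.ne' ((key _ hw₁).trans (key _ hw₂).symm))
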